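/- arXiv:1902.08304 — 5 statements merged into one kernel-verified Lean document; each statement's English description precedes it below -/
import Mathlib

section
/- Let D be an n×d real matrix, let U be an n×r matrix and V an m×r matrix, each with orthonormal columns, and let Ω ⊆ {1,…,d}×{1,…,m} be an index set. Suppose there are constants α_u ≥ 0 and μ ≥ 0 such that every matrix H ∈ ℝ^{d×m} supported on Ω satisfies ‖D H‖_F ≤ √α_u · ‖H‖_F and ‖𝒫_L(D H)‖_F ≤ μ · ‖D H‖_F. Then ‖𝒫_Ω(Dᵀ U Vᵀ)‖_F ≤ μ √(r α_u). -/
open Matrix BigOperators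
open scoped Classical

/-- Frobenius norm of a real matrix. -/
noncomputable def frob {n m : ℕ} (X : Matrix (Fin n) (Fin m) ℝ) : ℝ :=
  Real.sqrt (∑ i, ∑ j, X i j ^ 2)

/-- The projection operator `𝒫_L(X) = P X + X Q − P X Q`. -/
def PL {n m : ℕ} (P : Matrix (Fin n) (Fin n) ℝ) (Q : Matrix (Fin m) (Fin m) ℝ)
    (X : Matrix (Fin n) (Fin m) ℝ) : Matrix (Fin n) (Fin m) ℝ :=
  P * X + X * Q - P * X * Q

/-- Entry-wise projection onto an index set Ω: agrees with `X` on Ω, zero elsewhere. -/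
noncomputable def projE {d m : ℕ} (Ω : Set (Fin d × Fin m))
    (X : Matrix (Fin d) (Fin m) ℝ) : Matrix (Fin d) (Fin m) ℝ :=
  fun i j => if (i, j) ∈ Ω then X i j else 0

theorem frob_nonneg' {n m : ℕ} (X : Matrix (Fin n) (Fin m) ℝ) : 0 ≤ frob X :=
  Real.sqrt_nonneg _

theorem trace_eq_sum' {n m : ℕ} (X Y : Matrix (Fin n) (Fin m) ℝ) :
    (Xᵀ * Y).trace = ∑ i, ∑ j, X i j * Y i j := by
  simp only [Matrix.trace, Matrix.diag, Matrix.mul_apply, Matrix.transpose_apply]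
  exact Finset.sum_comm

theorem frob_sq' {n m : ℕ} (X : Matrix (Fin n) (Fin m) ℝ) :
    frob X ^ 2 = (Xᵀ * X).trace := by
  rw [trace_eq_sum', frob, Real.sq_sqrt]
  · simp only [sq]
  · positivity

theorem trace_le_frob' {n m : ℕ} (X Y : Matrix (Fin n) (Fin m) ℝ) :
    (Xᵀ * Y).trace ≤ frob X * frob Y := by
  rw [trace_eq_sum', frob, frob]
  simp only [← Fintype.sum_prod_type']
  exact Real.sum_mul_le_sqrt_mul_sqrt _ _ _

theorem stmt1 {n d m r : ℕ}
    (D : Matrix (Fin n) (Fin d) ℝ)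
    (U : Matrix (Fin n) (Fin r) ℝ) (V : Matrix (Fin m) (Fin r) ℝ)
    (hU : Uᵀ * U = 1) (hV : Vᵀ * V = 1)
    (Ω : Set (Fin d × Fin m))
    (αu μ : ℝ) (hαu : 0 ≤ αu) (hμ : 0 ≤ μ)
    (hup : ∀ H : Matrix (Fin d) (Fin m) ℝ, (∀ i j, (i, j) ∉ Ω → H i j = 0) →
      frob (D * H) ≤ Real.sqrt αu * frob H)
    (hinc : ∀ H : Matrix (Fin d) (Fin m) ℝ, (∀ i j, (i, j) ∉ Ω → H i j = 0) →
      frob (PL (U * Uᵀ) (V * Vᵀ) (D * H)) ≤ μ * frob (D * H)) :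
    frob (projE Ω (Dᵀ * U * Vᵀ)) ≤ μ * Real.sqrt (r * αu) := by
  set H := projE Ω (Dᵀ * U * Vᵀ) with hH
  have hs : ∀ i j, (i, j) ∉ Ω → H i j = 0 := by
    intro i j hij
    simp [hH, projE, hij]
  have h1 := hup H hs
  have h2 := hinc H hs
  have e1 : frob H ^ 2 = (Hᵀ * (Dᵀ * U * Vᵀ)).trace := by
    rw [frob_sq', trace_eq_sum', trace_eq_sum']
    refine Finset.sum_congr rfl fun i _ => Finset.sum_congr rfl fun j _ => ?_
    by_cases hij : (i, j) ∈ Ω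
    · simp [hH, projE, hij]
    · simp [hs i j hij]
  have hPU : U * Uᵀ * (U * Vᵀ) = U * Vᵀ := by
    rw [Matrix.mul_assoc, ← Matrix.mul_assoc Uᵀ, hU, Matrix.one_mul]
  have e2 : Hᵀ * (Dᵀ * U * Vᵀ) = (PL (U * Uᵀ) (V * Vᵀ) (D * H))ᵀ * (U * Vᵀ) := by
    have t : (PL (U * Uᵀ) (V * Vᵀ) (D * H))ᵀ = (D * H)ᵀ * (U * Uᵀ) + (V * Vᵀ) * (D * H)ᵀ
        - (V * Vᵀ) * ((D * H)ᵀ * (U * Uᵀ)) := by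
      simp only [PL, Matrix.transpose_sub, Matrix.transpose_add, Matrix.transpose_mul,
        Matrix.transpose_transpose]
    rw [t, Matrix.sub_mul, Matrix.add_mul, Matrix.mul_assoc (V * Vᵀ), Matrix.mul_assoc (V * Vᵀ),
      Matrix.mul_assoc (D * H)ᵀ, hPU, add_sub_cancel_right, Matrix.transpose_mul]
    simp only [Matrix.mul_assoc]
  have e3 : frob (U * Vᵀ) = Real.sqrt r := by
    have : frob (U * Vᵀ) ^ 2 = r := by
      rw [frob_sq', Matrix.transpose_mul, Matrix.transpose_transpose, Matrix.mul_assoc,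
        ← Matrix.mul_assoc Uᵀ, hU, Matrix.one_mul, Matrix.trace_mul_comm, hV]
      simp
    rw [← this, Real.sqrt_sq (frob_nonneg' _)]
  have h3 := trace_le_frob' (PL (U * Uᵀ) (V * Vᵀ) (D * H)) (U * Vᵀ)
  rw [← e2, ← e1, e3] at h3
  rw [Real.sqrt_mul (Nat.cast_nonneg r)]
  have h4 : frob H ^ 2 ≤ (μ * (Real.sqrt r * Real.sqrt αu)) * frob H := by
    calc frob H ^ 2 ≤ _ := h3
      _ ≤ (μ * (Real.sqrt αu * frob H)) * Real.sqrt r := by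
        gcongr
        exact h2.trans (by gcongr)
      _ = _ := by ring
  rcases (frob_nonneg' H).eq_or_lt with h0 | h0
  · rw [← h0]; positivity
  · rw [sq] at h4
    exact le_of_mul_le_mul_right h4 h0
end

section
/- Let D be an n×d real matrix, let U be an n×r matrix and V an m×r matrix, each with orthonormal columns, and let C ⊆ {1,…,m}. Suppose there are constants α_ℓ > 0 and 0 ≤ μ < 1 such that every matrix H ∈ ℝ^{d×m} with column support contained in C satisfies ‖D H‖_F ≥ √α_ℓ · ‖H‖_F and ‖𝒫_L(D H)‖_F ≤ μ · ‖D H‖_F. Then every H ∈ ℝ^{d×m} with column support contained in C satisfies ‖(I_n − P_U) D H (I_m − P_V)‖_F ≥ √α_ℓ · (1 − μ) · ‖H‖_F. -/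
open Matrix BigOperators

theorem frob_add_le {n m : ℕ} (X Y : Matrix (Fin n) (Fin m) ℝ) :
    frob (X + Y) ≤ frob X + frob Y := by
  have key : ∀ Z : Matrix (Fin n) (Fin m) ℝ,
      frob Z = ‖(WithLp.toLp 2 (fun p : Fin n × Fin m => Z p.1 p.2) :
        EuclideanSpace ℝ (Fin n × Fin m))‖ := by
    intro Z
    rw [EuclideanSpace.norm_eq, frob, Fintype.sum_prod_type]
    simp
  rw [key, key, key]
  exact norm_add_le
    (WithLp.toLp 2 (fun p : Fin n × Fin m => X p.1 p.2) : EuclideanSpace ℝ (Fin n × Fin m))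
    (WithLp.toLp 2 (fun p : Fin n × Fin m => Y p.1 p.2) : EuclideanSpace ℝ (Fin n × Fin m))

theorem stmt3 {n d m r : ℕ}
    (D : Matrix (Fin n) (Fin d) ℝ)
    (U : Matrix (Fin n) (Fin r) ℝ) (V : Matrix (Fin m) (Fin r) ℝ)
    (hU : Uᵀ * U = 1) (hV : Vᵀ * V = 1)
    (C : Set (Fin m))
    (αℓ μ : ℝ) (hαℓ : 0 < αℓ) (hμ0 : 0 ≤ μ) (hμ1 : μ < 1)
    (hlow : ∀ H : Matrix (Fin d) (Fin m) ℝ, (∀ j ∉ C, ∀ i, H i j = 0) →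
      Real.sqrt αℓ * frob H ≤ frob (D * H))
    (hinc : ∀ H : Matrix (Fin d) (Fin m) ℝ, (∀ j ∉ C, ∀ i, H i j = 0) →
      frob (PL (U * Uᵀ) (V * Vᵀ) (D * H)) ≤ μ * frob (D * H)) :
    ∀ H : Matrix (Fin d) (Fin m) ℝ, (∀ j ∉ C, ∀ i, H i j = 0) →
      Real.sqrt αℓ * (1 - μ) * frob H ≤
        frob ((1 - U * Uᵀ) * (D * H) * (1 - V * Vᵀ)) := by
  intro H hH
  have h1 := hlow H hH
  have h2 := hinc H hH
  have h3 : D * H = PL (U * Uᵀ) (V * Vᵀ) (D * H)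
      + (1 - U * Uᵀ) * (D * H) * (1 - V * Vᵀ) := by
    generalize D * H = X
    generalize U * Uᵀ = P
    generalize V * Vᵀ = Q
    simp only [PL, Matrix.sub_mul, Matrix.mul_sub, Matrix.one_mul, Matrix.mul_one]
    abel
  have h4 := frob_add_le (PL (U * Uᵀ) (V * Vᵀ) (D * H))
    ((1 - U * Uᵀ) * (D * H) * (1 - V * Vᵀ))
  rw [← h3] at h4
  have h5 := mul_le_mul_of_nonneg_left h1 (sub_nonneg.2 hμ1.le)
  linarith
end

section
/- Let 𝒰 ⊆ ℝⁿ be a linear subspace with orthogonal projection matrix P_U, let P_V ∈ ℝ^{m×m} be a symmetric idempotent matrix, let D ∈ ℝ^{n×d}, and let C ⊆ {1,…,m}. Let L, L₀ ∈ ℝ^{n×m} have all of their columns in 𝒰, and suppose the columns of L indexed by j ∉ C span 𝒰. Let S, S₀ ∈ ℝ^{d×m} each have column support contained in C, and suppose L + D S = L₀ + D S₀. Assume that for every nonzero matrix Z of the form Z = D H with H ∈ ℝ^{d×m} having column support contained in C, ‖𝒫_L(Z)‖_F < ‖Z‖_F (i.e., the incoherence parameter μ satisfies μ < 1). Then the column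 span of L₀ equals 𝒰, and the set of indices j with (D S₀)_{:,j} ≠ 0 equals the set of indices j with (D S)_{:,j} ≠ 0. -/
open Matrix BigOperators

theorem stmt5 {n m d : ℕ}
    (𝒰 : Submodule ℝ (Fin n → ℝ))
    (PU : Matrix (Fin n) (Fin n) ℝ)
    (hPUsymm : PUᵀ = PU) (hPUidem : PU * PU = PU)
    (hPUrange : ∀ v : Fin n → ℝ, PU.mulVec v ∈ 𝒰)
    (hPUfix : ∀ v ∈ 𝒰, PU.mulVec v = v)
    (PV : Matrix (Fin m) (Fin m) ℝ)
    (hPVsymm : PVᵀ = PV) (hPVidem : PV * PV = PV)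
    (D : Matrix (Fin n) (Fin d) ℝ) (C : Set (Fin m))
    (L L₀ : Matrix (Fin n) (Fin m) ℝ)
    (hL : ∀ j : Fin m, (fun i => L i j) ∈ 𝒰)
    (hL₀ : ∀ j : Fin m, (fun i => L₀ i j) ∈ 𝒰)
    (hspan : Submodule.span ℝ {v : Fin n → ℝ | ∃ j ∉ C, v = fun i => L i j} = 𝒰)
    (S S₀ : Matrix (Fin d) (Fin m) ℝ)
    (hS : ∀ j ∉ C, ∀ i, S i j = 0) (hS₀ : ∀ j ∉ C, ∀ i, S₀ i j = 0)
    (heq : L + D * S = L₀ + D * S₀)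
    (hμ : ∀ H : Matrix (Fin d) (Fin m) ℝ, (∀ j ∉ C, ∀ i, H i j = 0) →
      D * H ≠ 0 → frob (PL PU PV (D * H)) < frob (D * H)) :
    Submodule.span ℝ {v : Fin n → ℝ | ∃ j : Fin m, v = fun i => L₀ i j} = 𝒰 ∧
    {j : Fin m | (fun i => (D * S₀) i j) ≠ 0} = {j : Fin m | (fun i => (D * S) i j) ≠ 0} := by
  have hZ : D * (S - S₀) = L₀ - L := by
    rw [Matrix.mul_sub, sub_eq_sub_iff_add_eq_add, add_comm, heq]
  have hfix : PU * (L₀ - L) = L₀ - L := by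
    ext i j
    have h := hPUfix _ (𝒰.sub_mem (hL₀ j) (hL j))
    exact congrFun h i
  have hPL : PL PU PV (D * (S - S₀)) = D * (S - S₀) := by
    rw [hZ, PL, hfix]
    abel
  have h0 : D * (S - S₀) = 0 := by
    by_contra hne
    have h := hμ (S - S₀) (fun j hj i => by simp [hS j hj i, hS₀ j hj i]) hne
    rw [hPL] at h
    exact lt_irrefl _ h
  have hLL : L₀ = L := sub_eq_zero.mp (hZ.symm.trans h0)
  have hDS : D * S = D * S₀ := by
    rw [Matrix.mul_sub] at h0
    exact sub_eq_zero.mp h0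
  refine ⟨?_, by rw [hDS]⟩
  rw [hLL]
  apply le_antisymm
  · rw [Submodule.span_le]
    rintro v ⟨j, rfl⟩
    exact hL j
  · conv_lhs => rw [← hspan]
    apply Submodule.span_mono
    rintro v ⟨j, _, hv⟩
    exact ⟨j, hv⟩
end

section
/- Let D be an n×d real matrix and suppose there are constants 0 < α_ℓ ≤ α_u such that α_ℓ ‖v‖² ≤ ‖D v‖² ≤ α_u ‖v‖² for all v ∈ ℝ^d. Then for any two distinct standard basis vectors e_j, e_l of ℝ^d (j ≠ l), |⟨D e_j, D e_l⟩| ≤ (α_u − α_ℓ)/2. -/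
open Matrix BigOperators

theorem stmt6 {n d : ℕ} (D : Matrix (Fin n) (Fin d) ℝ) (αℓ αu : ℝ)
    (hαℓ : 0 < αℓ) (hle : αℓ ≤ αu)
    (hframe : ∀ v : Fin d → ℝ,
      αℓ * ∑ i, v i ^ 2 ≤ ∑ i, (D.mulVec v) i ^ 2 ∧
      ∑ i, (D.mulVec v) i ^ 2 ≤ αu * ∑ i, v i ^ 2)
    {j l : Fin d} (hjl : j ≠ l) :
    |∑ i, D i j * D i l| ≤ (αu - αℓ) / 2 := by
  have hn : ∀ c : ℝ, ∑ i, ((Pi.single j 1 + Pi.single l c : Fin d → ℝ) i) ^ 2 = 1 + c ^ 2 := by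
    intro c
    have h : ∀ i, ((Pi.single j 1 + Pi.single l c : Fin d → ℝ) i) ^ 2
        = (if i = j then 1 else 0) + (if i = l then c ^ 2 else 0) := by
      intro i
      simp only [Pi.add_apply, Pi.single_apply]
      by_cases h1 : i = j
      · have h2 : i ≠ l := fun h => hjl (h1.symm.trans h)
        simp [h1, hjl]
      · by_cases h2 : i = l <;> simp [h1, h2, hjl.symm]
    simp only [h, Finset.sum_add_distrib, Finset.sum_ite_eq', Finset.sum_ite_eq,
      Finset.mem_univ, if_true]
  have hD : ∀ c : ℝ, ∑ i, (D.mulVec (Pi.single j 1 + Pi.single l c)) i ^ 2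
      = ∑ i, D i j ^ 2 + 2 * c * ∑ i, D i j * D i l + c ^ 2 * ∑ i, D i l ^ 2 := by
    intro c
    rw [Finset.mul_sum, Finset.mul_sum, ← Finset.sum_add_distrib, ← Finset.sum_add_distrib]
    refine Finset.sum_congr rfl fun i _ => ?_
    simp [Matrix.mulVec_add, Matrix.mulVec_single]
    ring
  have h1 := hframe (Pi.single j 1 + Pi.single l 1)
  have h2 := hframe (Pi.single j 1 + Pi.single l (-1))
  rw [hn, hD] at h1 h2
  rw [abs_le]
  constructor <;> linarith [h1.1, h1.2, h2.1, h2.2]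
end

section
/- Let D be an n×d real matrix and P_U ∈ ℝ^{n×n} a symmetric idempotent matrix. Suppose there are constants 0 < α_ℓ ≤ α_u such that α_ℓ ‖v‖² ≤ ‖D v‖² ≤ α_u ‖v‖² for all v ∈ ℝ^d, and a constant γ_U ≥ 0 such that ‖P_U D e_i‖² ≤ γ_U ‖D e_i‖² for every standard basis vector e_i of ℝ^d. Then for any distinct indices j ≠ l, |e_jᵀ Dᵀ (I_n − P_U) D e_l| ≤ α_u (1 + 2 γ_U)/2 − α_ℓ/2. -/
open Matrix BigOperators

theorem stmt7 {n d : ℕ} (D : Matrix (Fin n) (Fin d) ℝ)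
    (PU : Matrix (Fin n) (Fin n) ℝ)
    (hsym : PUᵀ = PU) (hidem : PU * PU = PU)
    (αℓ αu γU : ℝ) (hαℓ : 0 < αℓ) (hle : αℓ ≤ αu) (hγ : 0 ≤ γU)
    (hframe : ∀ v : Fin d → ℝ,
      αℓ * ∑ i, v i ^ 2 ≤ ∑ i, (D.mulVec v) i ^ 2 ∧
      ∑ i, (D.mulVec v) i ^ 2 ≤ αu * ∑ i, v i ^ 2)
    (hγU : ∀ i : Fin d, ∑ k, ((PU * D) k i) ^ 2 ≤ γU * ∑ k, (D k i) ^ 2)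
    {j l : Fin d} (hjl : j ≠ l) :
    |((Dᵀ * (1 - PU) * D : Matrix (Fin d) (Fin d) ℝ)) j l| ≤
      αu * (1 + 2 * γU) / 2 - αℓ / 2 := by
  have hsingle : ∀ i : Fin d, ∑ k, (D k i) ^ 2 ≤ αu := by
    intro i
    have h := (hframe (Pi.single i 1)).2
    have e : ∑ k, (Pi.single i (1 : ℝ) : Fin d → ℝ) k ^ 2 = 1 := by
      rw [Finset.sum_eq_single i]
      · simp
      · intro b _ hb
        simp [Pi.single_eq_of_ne hb]
      · simp
    rw [e] at h
    simpa using h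
  have hlj : l ≠ j := fun h => hjl h.symm
  have hpair : ∀ s : ℝ, s ^ 2 = 1 →
      ∑ k, (Pi.single j (1 : ℝ) + s • Pi.single l (1 : ℝ) : Fin d → ℝ) k ^ 2 = 2 := by
    intro s hs
    have e : ∀ k, (Pi.single j (1 : ℝ) + s • Pi.single l (1 : ℝ) : Fin d → ℝ) k ^ 2
        = (if k = j then 1 else 0) + (if k = l then 1 else 0) := by
      intro k
      by_cases h1 : k = j
      · subst h1
        simp [Pi.single_apply, hjl]
      · by_cases h2 : k = l
        · subst h2
          simp [Pi.single_apply, hlj, hs]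
        · simp [Pi.single_apply, h1, h2]
    rw [Finset.sum_congr rfl (fun k _ => e k), Finset.sum_add_distrib]
    simp
    norm_num
  have hexp : ∀ s : ℝ, s ^ 2 = 1 →
      ∑ i, (D.mulVec (Pi.single j (1 : ℝ) + s • Pi.single l (1 : ℝ))) i ^ 2
        = ∑ k, D k j ^ 2 + ∑ k, D k l ^ 2 + 2 * s * ∑ k, D k j * D k l := by
    intro s hs
    rw [Finset.mul_sum, ← Finset.sum_add_distrib, ← Finset.sum_add_distrib]
    refine Finset.sum_congr rfl fun k _ => ?_
    simp only [Matrix.mulVec_add, Matrix.mulVec_smul, Matrix.mulVec_single_one, Pi.add_apply,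
      Pi.smul_apply, Matrix.col_apply, smul_eq_mul]
    linear_combination (D k l) ^ 2 * hs
  have hp := hframe (Pi.single j (1 : ℝ) + (1 : ℝ) • Pi.single l (1 : ℝ))
  have hm := hframe (Pi.single j (1 : ℝ) + (-1 : ℝ) • Pi.single l (1 : ℝ))
  rw [hpair 1 (by norm_num), hexp 1 (by norm_num)] at hp
  rw [hpair (-1) (by norm_num), hexp (-1) (by norm_num)] at hm
  have hentry : (Dᵀ * (1 - PU) * D : Matrix (Fin d) (Fin d) ℝ) j l
      = ∑ k, D k j * D k l - ∑ k, (PU * D) k j * (PU * D) k l := by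
    have e : Dᵀ * (1 - PU) * D = Dᵀ * D - (PU * D)ᵀ * (PU * D) := by
      rw [Matrix.transpose_mul, hsym, Matrix.mul_assoc Dᵀ PU, ← Matrix.mul_assoc PU PU, hidem,
        Matrix.mul_sub, Matrix.sub_mul, Matrix.mul_one, Matrix.mul_assoc]
    rw [e, Matrix.sub_apply, Matrix.mul_apply, Matrix.mul_apply]
    simp only [Matrix.transpose_apply]
  have hj := (hγU j).trans (mul_le_mul_of_nonneg_left (hsingle j) hγ)
  have hl := (hγU l).trans (mul_le_mul_of_nonneg_left (hsingle l) hγ)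
  have hq : ∀ s : ℝ, s ^ 2 = 1 → 0 ≤ ∑ k, ((PU * D) k j) ^ 2 + ∑ k, ((PU * D) k l) ^ 2
      + 2 * s * ∑ k, (PU * D) k j * (PU * D) k l := by
    intro s hs
    rw [Finset.mul_sum, ← Finset.sum_add_distrib, ← Finset.sum_add_distrib]
    refine Finset.sum_nonneg fun k _ => ?_
    have : (PU * D) k j ^ 2 + (PU * D) k l ^ 2 + 2 * s * ((PU * D) k j * (PU * D) k l)
        = ((PU * D) k j + s * (PU * D) k l) ^ 2 := by
      linear_combination -((PU * D) k l) ^ 2 * hs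
    rw [this]
    positivity
  have hq1 := hq 1 (by norm_num)
  have hq2 := hq (-1) (by norm_num)
  rw [hentry, abs_le]
  constructor <;> linarith [hp.1, hp.2, hm.1, hm.2]
end
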